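/- arXiv:1909.13729 — 2 statements merged into one kernel-verified Lean document; each statement's English description precedes it below -/
import Mathlib

section
/- Let R ⊊ S be a distributive FCP ring extension which is a P-extension, with Loewy series {S_i} and Loewy length n ≥ 1. Then for every i < n, S_i = sInf {A ∈ [R,S] | S_i ≤ A and A ⋖ S_{i+1}} (S_i is the infimum of the coatoms of the interval [S_i, S_{i+1}]); moreover the radical of the extension satisfies sInf {A ∈ [R,S] | A ⋖ ⊤} = S_{n-1}. -/
/-- The Loewy series of the ring extension `R ⊆ S`: `S_0 = ⊥` and
`S_{i+1} = S_i ⊔ sSup {A | S_i ⋖ A}`. -/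
noncomputable def loewySeries (R S : Type*) [CommRing R] [CommRing S] [Algebra R S] :
    ℕ → Subalgebra R S
  | 0 => ⊥
  | n + 1 => loewySeries R S n ⊔ sSup {A : Subalgebra R S | loewySeries R S n ⋖ A}

/-- In a distributive lattice with both chain conditions, if `b` is the join of `a` and the covers
of `a`, then `a` is the meet of the coatoms of the interval `[a, b]`. -/
theorem sInf_covBy_eq_of_sup_sSup_covBy {L : Type*} [CompleteLattice L]
    [WellFoundedLT L] [WellFoundedGT L]
    (hdist : ∀ a b c : L, a ⊓ (b ⊔ c) = (a ⊓ b) ⊔ (a ⊓ c))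
    {a b : L} (hab : a < b) (hb : b = a ⊔ sSup {c | a ⋖ c}) :
    sInf {c | a ≤ c ∧ c ⋖ b} = a := by
  have : IsModularLattice L := ⟨fun {x} y {z} hxz => by
    rw [inf_comm, hdist, inf_comm z x, inf_eq_left.2 hxz, inf_comm z y]⟩
  have hle : a ≤ sInf {c | a ≤ c ∧ c ⋖ b} := le_sInf fun c hc => hc.1
  by_contra hne
  obtain ⟨p, hap, hpx⟩ := exists_covBy_le_of_lt (hle.lt_of_ne' hne)
  obtain ⟨d, had, hdb⟩ := exists_le_covBy_of_lt hab
  have hpb : p ≤ b := (hpx.trans (sInf_le ⟨had, hdb⟩)).trans hdb.le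
  -- a relative complement `q` of `p` in `[a, b]`
  obtain ⟨q, ⟨haq, hqb, hqp⟩, hmax⟩ := wellFounded_gt.has_min
    {q : L | a ≤ q ∧ q ≤ b ∧ p ⊓ q = a} ⟨a, le_rfl, hab.le, inf_eq_right.2 hap.le⟩
  have hsup : p ⊔ q = b := by
    refine le_antisymm (sup_le hpb hqb) ?_
    conv_lhs => rw [hb]
    refine sup_le (haq.trans le_sup_right) (sSup_le fun r (hr : a ⋖ r) => ?_)
    rcases eq_or_ne r p with rfl | hrp
    · exact le_sup_left
    have hpr : p ⊓ r = a := by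
      refine (hap.eq_or_eq (le_inf hap.le hr.le) inf_le_left).resolve_right fun h => hrp ?_
      exact ((hr.eq_or_eq hap.le (inf_eq_left.1 h)).resolve_left hap.lt.ne').symm
    have hrb : r ≤ b := by
      rw [hb]
      exact (le_sSup (show r ∈ {c | a ⋖ c} from hr)).trans le_sup_right
    have hmem : p ⊓ (q ⊔ r) = a := by rw [hdist, hqp, hpr, sup_idem]
    have hnot := hmax (q ⊔ r) ⟨haq.trans le_sup_left, sup_le hqb hrb, hmem⟩
    have hrq : r ≤ q := by
      by_contra h
      exact hnot (left_lt_sup.2 h)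
    exact hrq.trans le_sup_right
  have hcov : q ⋖ b := by
    rw [← hsup]
    exact covBy_sup_of_inf_covBy_left (by rwa [hqp])
  have hpq : p ≤ q := hpx.trans (sInf_le ⟨haq, hcov⟩)
  exact hap.lt.ne' (by rw [← hqp, inf_eq_left.2 hpq])

theorem loewySeries_monotone (R S : Type*) [CommRing R] [CommRing S] [Algebra R S] :
    Monotone (loewySeries R S) :=
  monotone_nat_of_le_succ fun _ => le_sup_left

/-- With the descending chain condition, the Loewy series increases strictly until it reaches `⊤`. -/
theorem loewySeries_lt_succ {R S : Type*} [CommRing R] [CommRing S] [Algebra R S]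
    [WellFoundedLT (Subalgebra R S)] {i : ℕ} (hi : loewySeries R S i ≠ ⊤) :
    loewySeries R S i < loewySeries R S (i + 1) := by
  obtain ⟨A, hA, -⟩ := exists_covBy_le_of_lt (lt_top_iff_ne_top.2 hi)
  exact hA.lt.trans_le ((le_sSup (show A ∈ {B | loewySeries R S i ⋖ B} from hA)).trans le_sup_right)

theorem loewySeries_eq_radical_of_steps
    {R S : Type*} [CommRing R] [CommRing S] [Algebra R S]
    (hinj : Function.Injective (algebraMap R S))
    [WellFoundedLT (Subalgebra R S)] [WellFoundedGT (Subalgebra R S)]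
    (hRS : (⊥ : Subalgebra R S) ≠ ⊤)
    (hdist : ∀ a b c : Subalgebra R S, a ⊓ (b ⊔ c) = (a ⊓ b) ⊔ (a ⊓ c))
    (n : ℕ) (hn : IsLeast {m : ℕ | loewySeries R S m = ⊤} n) (hn1 : 1 ≤ n)
    (hP : ∀ T : Subalgebra R S, ∃ i < n,
      loewySeries R S i ≤ T ∧ T ≤ loewySeries R S (i + 1)) :
    (∀ i < n, loewySeries R S i =
      sInf {A : Subalgebra R S |
        loewySeries R S i ≤ A ∧ A ⋖ loewySeries R S (i + 1)}) ∧
    sInf {A : Subalgebra R S | A ⋖ ⊤} = loewySeries R S (n - 1) := by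
  have hne : ∀ i < n, loewySeries R S i ≠ ⊤ := fun i hi h => hi.not_ge (hn.2 h)
  have hsteps : ∀ i < n, loewySeries R S i =
      sInf {A : Subalgebra R S |
        loewySeries R S i ≤ A ∧ A ⋖ loewySeries R S (i + 1)} := fun i hi =>
    (sInf_covBy_eq_of_sup_sSup_covBy hdist (loewySeries_lt_succ (hne i hi)) rfl).symm
  refine ⟨hsteps, ?_⟩
  have hlast : n - 1 < n := by omega
  rw [hsteps (n - 1) hlast, Nat.sub_add_cancel hn1, show loewySeries R S n = ⊤ from hn.1]
  congr 1
  ext A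
  refine ⟨fun hA => ⟨?_, hA⟩, fun hA => hA.2⟩
  obtain ⟨i, hi, hiA, hAi⟩ := hP A
  rcases (Nat.le_sub_one_of_lt hi).eq_or_lt with rfl | hlt
  · exact hiA
  · have hle : A ≤ loewySeries R S (n - 1) := hAi.trans (loewySeries_monotone R S hlt)
    exact ((hA.eq_or_eq hle le_top).resolve_right (hne _ hlast)).le
end

section
/- Let k ⊊ L be a finite Galois field extension whose Galois group L ≃ₐ[k] L is cyclic and set n := Module.finrank k L. Then: (1) an intermediate field T ∈ [k,L] satisfies (T ≠ ⊥ and T is join-irreducible, i.e. T = U ⊔ V implies T = U or T = V) if and only if Module.finrank k T is a prime power p^β with β ≥ 1 (IsPrimePow); (2) the number of intermediate fields of k ⊆ L equals the number of divisors of n, i.e. Nat.card (IntermediateField k L) = n.divisors.card; (3) the supremum of the lengths of chains in [k,L] equals the number of prime factors of n counted with multiplicity, Σ_{p ∈ n.primeFactors} n.factorization p. -/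
/-- In a finite cyclic group, inclusion of subgroups is governed by divisibility of their orders. -/
theorem Subgroup.le_of_card_dvd_card {G : Type*} [Group G] [Finite G] [IsCyclic G]
    {H K : Subgroup G} (h : Nat.card H ∣ Nat.card K) : H ≤ K := by
  classical
  have := Fintype.ofFinite G
  have hsub : (K : Set G).toFinset ⊆ ({x | x ^ Nat.card K = 1} : Finset G) := fun x hx => by
    simpa using orderOf_dvd_iff_pow_eq_one.1 (K.orderOf_dvd_natCard (by simpa using hx))
  have heq := Finset.eq_of_subset_of_card_le hsub <| by
    rw [Set.toFinset_card, ← Nat.card_eq_fintype_card]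
    exact IsCyclic.card_pow_eq_one_le Nat.card_pos
  intro x hx
  have hx1 : x ^ Nat.card K = 1 :=
    orderOf_dvd_iff_pow_eq_one.1 ((H.orderOf_dvd_natCard hx).trans h)
  have hmem : x ∈ (K : Set G).toFinset := by rw [heq]; simpa using hx1
  simpa using hmem

theorem Subgroup.le_of_index_dvd_index {G : Type*} [Group G] [Finite G] [IsCyclic G]
    {H K : Subgroup G} (h : K.index ∣ H.index) : H ≤ K := by
  apply Subgroup.le_of_card_dvd_card
  obtain ⟨c, hc⟩ := h
  refine ⟨c, Nat.eq_of_mul_eq_mul_right (Nat.pos_of_ne_zero K.index_ne_zero_of_finite) ?_⟩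
  rw [K.card_mul_index, ← H.card_mul_index, hc]
  ring

theorem IsCyclic.exists_subgroup_index_eq {G : Type*} [Group G] [Finite G] [IsCyclic G]
    {d : ℕ} (hd : d ∣ Nat.card G) : ∃ H : Subgroup G, H.index = d := by
  obtain ⟨g, hg⟩ := IsCyclic.exists_ofOrder_eq_natCard (α := G)
  have hd0 : 0 < d := Nat.pos_of_dvd_of_pos hd Nat.card_pos
  refine ⟨Subgroup.zpowers (g ^ d), ?_⟩
  have hcard : Nat.card (Subgroup.zpowers (g ^ d)) * d = Nat.card G := by
    rw [Nat.card_zpowers, orderOf_pow_of_dvd hd0.ne' (hg ▸ hd), hg, Nat.div_mul_cancel hd]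
  exact Nat.eq_of_mul_eq_mul_left Nat.card_pos ((Subgroup.card_mul_index _).trans hcard.symm)

namespace IntermediateField

theorem finrank_dvd_finrank_top {k L : Type*} [Field k] [Field L] [Algebra k L]
    (T : IntermediateField k L) :
    Module.finrank k T ∣ Module.finrank k L :=
  ⟨_, (Module.finrank_mul_finrank k T L).symm⟩

variable {k L : Type*} [Field k] [Field L] [Algebra k L]
    [FiniteDimensional k L] [IsGalois k L] [IsCyclic (L ≃ₐ[k] L)]

theorem finrank_dvd_finrank_iff_le {U V : IntermediateField k L} :
    Module.finrank k U ∣ Module.finrank k V ↔ U ≤ V := by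
  rw [finrank_eq_fixingSubgroup_index, finrank_eq_fixingSubgroup_index]
  refine ⟨fun h => ?_, fun h => Subgroup.index_dvd_of_le (fixingSubgroup_le h)⟩
  rw [← IsGalois.fixedField_fixingSubgroup U, ← IsGalois.fixedField_fixingSubgroup V]
  exact fixedField_le (Subgroup.le_of_index_dvd_index h)

theorem finrank_injective_of_isCyclic :
    Function.Injective fun T : IntermediateField k L => Module.finrank k T := fun _ _ h =>
  le_antisymm (finrank_dvd_finrank_iff_le.1 (dvd_of_eq h))
    (finrank_dvd_finrank_iff_le.1 (dvd_of_eq h.symm))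

theorem exists_finrank_eq_of_dvd {d : ℕ} (hd : d ∣ Module.finrank k L) :
    ∃ T : IntermediateField k L, Module.finrank k T = d := by
  rw [← IsGalois.card_aut_eq_finrank] at hd
  obtain ⟨H, hH⟩ := IsCyclic.exists_subgroup_index_eq hd
  refine ⟨fixedField H, ?_⟩
  rw [finrank_eq_fixingSubgroup_index, fixingSubgroup_fixedField, hH]

theorem joinIrreducible_iff_isPrimePow_finrank (T : IntermediateField k L) :
    (T ≠ ⊥ ∧ ∀ U V : IntermediateField k L, T = U ⊔ V → T = U ∨ T = V) ↔
      IsPrimePow (Module.finrank k T) := by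
  constructor
  · rintro ⟨hT, hirr⟩
    have hne : Module.finrank k T ≠ 1 := fun h => hT (finrank_eq_one_iff.1 h)
    obtain ⟨p, hp, hpT⟩ := Nat.exists_prime_and_dvd hne
    obtain ⟨e, b, hpb, heq⟩ := Nat.exists_eq_pow_mul_and_not_dvd
      (n := Module.finrank k T) Module.finrank_pos.ne' p hp.ne_one
    have hdvd := T.finrank_dvd_finrank_top
    obtain ⟨U, hU⟩ := exists_finrank_eq_of_dvd (k := k) (L := L) (d := p ^ e)
      ((Dvd.intro _ heq.symm).trans hdvd)
    obtain ⟨V, hV⟩ := exists_finrank_eq_of_dvd (k := k) (L := L) (d := b)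
      ((Dvd.intro_left _ heq.symm).trans hdvd)
    have hsup : T = U ⊔ V := by
      apply le_antisymm
      · rw [← finrank_dvd_finrank_iff_le, heq]
        apply ((hp.coprime_iff_not_dvd.2 hpb).pow_left e).mul_dvd_of_dvd_of_dvd
        · rw [← hU, finrank_dvd_finrank_iff_le]; exact le_sup_left
        · rw [← hV, finrank_dvd_finrank_iff_le]; exact le_sup_right
      · apply sup_le <;> rw [← finrank_dvd_finrank_iff_le]
        · exact hU ▸ Dvd.intro _ heq.symm
        · exact hV ▸ Dvd.intro_left _ heq.symm
    rcases hirr U V hsup with h | h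
    · rw [← h] at hU
      refine hU ▸ hp.isPrimePow.pow ?_
      rintro rfl
      exact hne (by simpa using hU)
    · rw [← h] at hV
      exact absurd (hV ▸ hpT) hpb
  · intro h
    refine ⟨fun hT => h.ne_one (finrank_eq_one_iff.2 hT), ?_⟩
    rintro U V rfl
    obtain ⟨p, e, hp, -, he⟩ := (isPrimePow_nat_iff _).1 h
    obtain ⟨i, -, hi⟩ := (Nat.dvd_prime_pow hp).1
      (he ▸ finrank_dvd_finrank_iff_le.2 (le_sup_left : U ≤ U ⊔ V))
    obtain ⟨j, -, hj⟩ := (Nat.dvd_prime_pow hp).1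
      (he ▸ finrank_dvd_finrank_iff_le.2 (le_sup_right : V ≤ U ⊔ V))
    rcases le_total i j with hij | hij
    · right
      rw [sup_eq_right, ← finrank_dvd_finrank_iff_le, hi, hj]
      exact pow_dvd_pow p hij
    · left
      rw [sup_eq_left, ← finrank_dvd_finrank_iff_le, hi, hj]
      exact pow_dvd_pow p hij

theorem natCard_eq_card_divisors_finrank :
    Nat.card (IntermediateField k L) = (Module.finrank k L).divisors.card := by
  rw [← Nat.card_eq_finsetCard]
  refine Nat.card_eq_of_bijective (fun T => ⟨Module.finrank k T,
    Nat.mem_divisors.2 ⟨T.finrank_dvd_finrank_top, Module.finrank_pos.ne'⟩⟩) ⟨?_, ?_⟩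
  · exact fun U V h => finrank_injective_of_isCyclic (congrArg Subtype.val h)
  · rintro ⟨d, hd⟩
    obtain ⟨T, hT⟩ := exists_finrank_eq_of_dvd (Nat.dvd_of_mem_divisors hd)
    exact ⟨T, Subtype.ext hT⟩

open ArithmeticFunction in
theorem strictMono_cardFactors_finrank :
    StrictMono fun T : IntermediateField k L => cardFactors (Module.finrank k T) := by
  intro U V hUV
  obtain ⟨c, hc⟩ := finrank_dvd_finrank_iff_le.2 hUV.le
  have hV : Module.finrank k V ≠ 0 := Module.finrank_pos.ne'
  have hc0 : c ≠ 0 := by rintro rfl; simp [hc] at hV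
  have hc1 : c ≠ 1 := by
    rintro rfl
    exact hUV.ne (finrank_injective_of_isCyclic (by simpa using hc.symm))
  have hpos : 0 < cardFactors c := cardFactors_pos_iff_one_lt.2 (by omega)
  change cardFactors (Module.finrank k U) < cardFactors (Module.finrank k V)
  rw [hc, cardFactors_mul Module.finrank_pos.ne' hc0]
  omega

open ArithmeticFunction in
theorem height_eq_cardFactors_finrank (T : IntermediateField k L) :
    Order.height T = cardFactors (Module.finrank k T) := by
  apply le_antisymm
  · simpa using Order.height_le_height_apply_of_strictMono _ strictMono_cardFactors_finrank T
  · induction hm : Module.finrank k T using Nat.strong_induction_on generalizing T with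
    | _ m ih =>
    by_cases hm1 : m = 1
    · simp [hm1]
    obtain ⟨p, hp, d, rfl⟩ := Nat.exists_prime_and_dvd hm1
    have hd0 : d ≠ 0 := by
      rintro rfl
      exact Module.finrank_pos.ne' (hm.trans (mul_zero p))
    have hdT : d ∣ Module.finrank k T := hm ▸ Dvd.intro_left p rfl
    obtain ⟨U, hU⟩ := exists_finrank_eq_of_dvd (hdT.trans T.finrank_dvd_finrank_top)
    have hlt : d < p * d := lt_mul_of_one_lt_left (Nat.pos_of_ne_zero hd0) hp.one_lt
    have hUT : U < T := by
      refine lt_of_le_of_ne (finrank_dvd_finrank_iff_le.1 (hU ▸ hdT)) ?_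
      rintro rfl
      exact hlt.ne (hU.symm.trans hm)
    rw [cardFactors_mul hp.ne_zero hd0, cardFactors_apply_prime hp, add_comm]
    push_cast
    exact (add_le_add_left (ih d hlt U hU) 1).trans (Order.height_add_one_le hUT)

end IntermediateField

theorem cyclic_galois_joinIrreducible_card_length
    {k L : Type*} [Field k] [Field L] [Algebra k L]
    [FiniteDimensional k L] [IsGalois k L] [IsCyclic (L ≃ₐ[k] L)]
    (hkL : (⊥ : IntermediateField k L) ≠ ⊤) :
    (∀ T : IntermediateField k L,
      (T ≠ ⊥ ∧ ∀ U V : IntermediateField k L, T = U ⊔ V → T = U ∨ T = V) ↔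
        IsPrimePow (Module.finrank k T)) ∧
    Nat.card (IntermediateField k L) = (Module.finrank k L).divisors.card ∧
    Order.krullDim (IntermediateField k L) =
      ((∑ p ∈ (Module.finrank k L).primeFactors,
        (Module.finrank k L).factorization p : ℕ) : WithBot ℕ∞) := by
  refine ⟨IntermediateField.joinIrreducible_iff_isPrimePow_finrank,
    IntermediateField.natCard_eq_card_divisors_finrank, ?_⟩
  rw [← Order.height_top_eq_krullDim, IntermediateField.height_eq_cardFactors_finrank,
    IntermediateField.finrank_top', ArithmeticFunction.cardFactors_eq_sum_factorization]
  rfl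
end
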